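/- arXiv:1506.07678 — 2 statements merged into one kernel-verified Lean document; each statement's English description precedes it below -/
import Mathlib

section
/- Let q be a prime power and n a positive integer. The number of similarity classes of n×n matrices over the finite field F_q equals the sum over partitions λ = (λ₁ ≥ λ₂ ≥ ...) of n of q^{λ₁}. -/
namespace SimCount
open Polynomial Module
variable {F : Type} [Field F]

open scoped Classical in
noncomputable def piDrop {R : Type} [CommRing R] {ι : Type} (M : ι → Type) [∀ i, AddCommGroup (M i)]
    [∀ i, Module R (M i)] (S : ι → Prop) (h : ∀ i, ¬ S i → Subsingleton (M i)) :
    ((i : ι) → M i) ≃ₗ[R] ((i : {i // S i}) → M i.1) :=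
  LinearEquiv.ofBijective (LinearMap.pi (fun i => LinearMap.proj i.1)) (by
    constructor
    · intro f g hfg
      funext i
      by_cases hi : S i
      · exact congrFun hfg ⟨i, hi⟩
      · have := h i hi
        exact Subsingleton.elim _ _
    · intro g
      refine ⟨fun i => if hi : S i then g ⟨i, hi⟩ else 0, ?_⟩
      funext i
      simp [i.2])

/-- monic irreducible polynomials -/
abbrev MI (F : Type) [Field F] := {p : F[X] // p.Monic ∧ Irreducible p}

noncomputable instance : DecidableEq (MI F) := Classical.decEq _

abbrev NMod (s : Multiset (MI F × ℕ)) : Type :=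
  (x : s.ToType) → F[X] ⧸ Ideal.span {(x.1.1.1 : F[X]) ^ (x.1.2 + 1)}

theorem exists_multiset (M : Type) [AddCommGroup M] [Module F[X] M] [Module.Finite F[X] M]
    (hM : Module.IsTorsion F[X] M) : ∃ s : Multiset (MI F × ℕ), Nonempty (M ≃ₗ[F[X]] NMod s) := by
  obtain ⟨ι, _, p, hp, e, ⟨φ⟩⟩ := Module.equiv_directSum_of_isTorsion hM
  classical
  let S : ι → Prop := fun i => e i ≠ 0
  let f : {i // S i} → MI F × ℕ := fun i =>
    (⟨normalize (p i.1), Polynomial.monic_normalize (hp i).ne_zero,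
      (normalize_associated (p i.1)).symm.irreducible (hp i)⟩, e i - 1)
  let s : Multiset (MI F × ℕ) := (Finset.univ : Finset {i // S i}).val.map f
  let u0 : ((Finset.univ : Finset {i // S i}).val).ToType ≃ {i // S i} :=
    { toFun := fun x => x.1
      invFun := fun i => ⟨i, ⟨0, by simp⟩⟩
      left_inv := by
        rintro ⟨x, y⟩
        have h1 : Multiset.count x (Finset.univ : Finset {i // S i}).val = 1 := by simp
        have : Subsingleton (Fin (Multiset.count x (Finset.univ : Finset {i // S i}).val)) := by
          rw [h1]; infer_instance
        exact Sigma.ext rfl (heq_of_eq (Subsingleton.elim _ _))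
      right_inv := fun i => rfl }
  let u : {i // S i} ≃ s.ToType := u0.symm.trans (Multiset.mapEquiv _ f)
  have hu : ∀ i, (u i).1 = f i := fun i => Multiset.mapEquiv_apply _ f _
  refine ⟨s, ⟨φ.trans ((DirectSum.linearEquivFunOnFintype F[X] ι _).trans
    ((piDrop _ S ?_).trans (LinearEquiv.trans (LinearEquiv.piCongrRight fun i => ?_)
      (LinearEquiv.piCongrLeft F[X] _ u))))⟩⟩
  · intro i hi
    have hi : e i = 0 := by simpa [S] using hi
    rw [hi, pow_zero]
    exact Ideal.Quotient.subsingleton_iff.mpr Ideal.span_singleton_one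
  · refine Submodule.quotEquivOfEq _ _ ?_
    have hi : e i.1 - 1 + 1 = e i.1 := Nat.sub_add_cancel (Nat.pos_of_ne_zero i.2)
    simp only [hu, f, hi]
    refine (Ideal.span_singleton_eq_span_singleton).mpr ?_
    exact (normalize_associated (p i.1)).symm.pow_pow

theorem card_quot [Fintype F] (f : F[X]) (hf : f ≠ 0) :
    Nat.card (F[X] ⧸ Ideal.span {f}) = Fintype.card F ^ f.natDegree := by
  have : Module.Finite F (F[X] ⧸ Ideal.span {f}) :=
    (AdjoinRoot.powerBasis hf).finite
  rw [← finrank_quotient_span_eq_natDegree (f := f), Module.natCard_eq_pow_finrank (K := F), Nat.card_eq_fintype_card]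

theorem similar_iff {n : ℕ} (A B : Matrix (Fin n) (Fin n) F) :
    (∃ g : GL (Fin n) F, B = (g : Matrix (Fin n) (Fin n) F) * A * ((g⁻¹ : GL (Fin n) F) : Matrix (Fin n) (Fin n) F)) ↔
    Nonempty (AEval' (Matrix.toLin' A) ≃ₗ[F[X]] AEval' (Matrix.toLin' B)) := by
  constructor
  · rintro ⟨g, rfl⟩
    refine ⟨LinearEquiv.ofAEval _ ((Matrix.GeneralLinearGroup.toLin g).toLinearEquiv.trans (AEval'.of _)) ?_⟩
    intro m
    simp only [LinearEquiv.trans_apply]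
    rw [AEval'.X_smul_of]
    congr 1
    simp
  · rintro ⟨φ⟩
    let ψ : (Fin n → F) ≃ₗ[F] (Fin n → F) :=
     (AEval'.of _).trans ((φ.restrictScalars F).trans (AEval'.of _).symm)
    have hψ : ∀ v, ψ (Matrix.toLin' A v) = Matrix.toLin' B (ψ v) := by
      intro v
      simp only [ψ, LinearEquiv.trans_apply]
      rw [← AEval'.X_smul_of, ← AEval'.of_symm_X_smul]
      simp
    refine ⟨⟨LinearMap.toMatrix' ψ.toLinearMap, LinearMap.toMatrix' ψ.symm.toLinearMap, ?_, ?_⟩, ?_⟩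
    · rw [← LinearMap.toMatrix'_comp]; simp
    · rw [← LinearMap.toMatrix'_comp]; simp
    · have h2 : Matrix.toLin' B = (ψ.toLinearMap ∘ₗ Matrix.toLin' A) ∘ₗ ψ.symm.toLinearMap := by
        refine LinearMap.ext fun v => ?_
        have h0 := hψ (ψ.symm v)
        simp only [ψ.apply_symm_apply] at h0
        exact h0.symm
      have h3 := congrArg LinearMap.toMatrix' h2
      rw [LinearMap.toMatrix'_comp, LinearMap.toMatrix'_comp, LinearMap.toMatrix'_toLin',
        LinearMap.toMatrix'_toLin'] at h3
      exact h3

theorem exists_matrix {n : ℕ} (N : Type) [AddCommGroup N] [Module F N] [Module F[X] N] [IsScalarTower F F[X] N]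
    (h : Module.finrank F N = n) [FiniteDimensional F N] :
    ∃ A : Matrix (Fin n) (Fin n) F, Nonempty (AEval' (Matrix.toLin' A) ≃ₗ[F[X]] N) := by
  let φ : (Fin n → F) ≃ₗ[F] N := LinearEquiv.ofFinrankEq _ _ (by simp [h])
  let T : (Fin n → F) →ₗ[F] (Fin n → F) :=
    φ.symm.toLinearMap ∘ₗ ((Algebra.lsmul F F N (X : F[X])) ∘ₗ φ.toLinearMap)
  refine ⟨LinearMap.toMatrix' T, ⟨LinearEquiv.ofAEval _ φ ?_⟩⟩
  intro m
  simp [T]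


theorem card_tensor {R : Type} [CommRing R] (I J : Ideal R) :
    Nat.card (TensorProduct R (R ⧸ I) (R ⧸ J)) = Nat.card (R ⧸ (I ⊔ J)) := by
  rw [Nat.card_congr (TensorProduct.quotTensorEquivQuotSMul (R ⧸ J) I).toEquiv,
    Ideal.smul_top_eq_map, sup_comm, ← Nat.card_congr (DoubleQuot.quotQuotEquivQuotSup J I).toEquiv]
  rfl

theorem card_single [Fintype F] (p r : MI F) (k e : ℕ) :
    Nat.card (TensorProduct F[X] (F[X] ⧸ Ideal.span {p.1 ^ k}) (F[X] ⧸ Ideal.span {r.1 ^ e})) =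
      Fintype.card F ^ ((if r = p then min k e else 0) * p.1.natDegree) := by
  rw [card_tensor]
  split_ifs with h
  · subst h
    have : Ideal.span {r.1 ^ k} ⊔ Ideal.span {r.1 ^ e} = Ideal.span {r.1 ^ (min k e)} := by
      rcases le_total k e with h | h
      · rw [min_eq_left h]
        exact sup_eq_left.mpr ((Ideal.span_singleton_le_span_singleton).mpr (pow_dvd_pow _ h))
      · rw [min_eq_right h]
        exact sup_eq_right.mpr ((Ideal.span_singleton_le_span_singleton).mpr (pow_dvd_pow _ h))
    rw [this, card_quot _ (pow_ne_zero _ r.2.1.ne_zero), natDegree_pow]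
  · have hc : IsCoprime (p.1 ^ k) (r.1 ^ e) := by
      apply IsCoprime.pow
      rw [(p.2.2).coprime_iff_not_dvd]
      intro hd
      apply h
      apply Subtype.ext
      exact (eq_of_monic_of_associated p.2.1 r.2.1 (p.2.2.associated_of_dvd r.2.2 hd)).symm
    rw [Ideal.sup_eq_top_iff_isCoprime _ _ |>.mpr hc]
    simp

theorem card_tensor_NMod [Fintype F] (s : Multiset (MI F × ℕ)) (p : MI F) (k : ℕ) :
    Nat.card (TensorProduct F[X] (F[X] ⧸ Ideal.span {p.1 ^ k}) (NMod s)) =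
      Fintype.card F ^ ((s.map fun x => if x.1 = p then min k (x.2 + 1) else 0).sum * p.1.natDegree) := by
  classical
  rw [Nat.card_congr (TensorProduct.piRight F[X] F[X] _ _).toEquiv, Nat.card_pi]
  simp_rw [card_single]
  rw [Finset.prod_pow_eq_pow_sum, ← Finset.sum_mul]
  congr 2
  conv_rhs => rw [← Multiset.map_univ_coe s, Multiset.map_map]
  rfl

theorem count_formula (s : Multiset (MI F × ℕ)) (p : MI F) (k : ℕ) :
    2 * (s.map fun x => if x.1 = p then min (k+1) (x.2 + 1) else 0).sum =
    (s.map fun x => if x.1 = p then min k (x.2 + 1) else 0).sum +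
    (s.map fun x => if x.1 = p then min (k+2) (x.2 + 1) else 0).sum + s.count (p, k) := by
  induction s using Multiset.induction_on with
  | empty => simp
  | cons a s ih =>
    simp only [Multiset.map_cons, Multiset.sum_cons, Multiset.count_cons, mul_add, ih]
    obtain ⟨r, j⟩ := a
    by_cases h : r = p
    · subst h
      simp only [if_true, Prod.mk.injEq, true_and]
      split_ifs <;> omega
    · have h' : ¬ p = r := fun h' => h h'.symm
      simp only [h, h', if_false, Prod.mk.injEq, false_and]
      omega

theorem unique [Fintype F] (s t : Multiset (MI F × ℕ)) (φ : NMod s ≃ₗ[F[X]] NMod t) : s = t := by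
  have key : ∀ (p : MI F) (k : ℕ), (s.map fun x => if x.1 = p then min k (x.2 + 1) else 0).sum =
     (t.map fun x => if x.1 = p then min k (x.2 + 1) else 0).sum := by
    intro p k
    have h := Nat.card_congr (TensorProduct.congr
      (LinearEquiv.refl F[X] (F[X] ⧸ Ideal.span {p.1 ^ k})) φ).toEquiv
    rw [card_tensor_NMod, card_tensor_NMod] at h
    exact Nat.eq_of_mul_eq_mul_right p.2.2.natDegree_pos (Nat.pow_right_injective Fintype.one_lt_card h)
  ext ⟨p, k⟩
  have h1 := count_formula s p k
  have h2 := count_formula t p k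
  simp only [key] at h1
  omega

theorem finite_NMod (s : Multiset (MI F × ℕ)) : Module.Finite F (NMod s) := by
  have (x : s.ToType) : Module.Finite F (F[X] ⧸ Ideal.span {(x.1.1.1 : F[X]) ^ (x.1.2 + 1)}) :=
    (AdjoinRoot.powerBasis (pow_ne_zero _ x.1.1.2.1.ne_zero)).finite
  infer_instance

theorem finrank_NMod (s : Multiset (MI F × ℕ)) :
    finrank F (NMod s) = (s.map fun x => (x.2 + 1) * x.1.1.natDegree).sum := by
  have (x : s.ToType) : Module.Finite F (F[X] ⧸ Ideal.span {(x.1.1.1 : F[X]) ^ (x.1.2 + 1)}) :=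
    (AdjoinRoot.powerBasis (pow_ne_zero _ x.1.1.2.1.ne_zero)).finite
  rw [Module.finrank_pi_fintype]
  conv_rhs => rw [← Multiset.map_univ_coe s, Multiset.map_map]
  simp_rw [finrank_quotient_span_eq_natDegree, natDegree_pow]
  rfl

abbrev DD (F : Type) [Field F] (n : ℕ) :=
  {s : Multiset (MI F × ℕ) // (s.map fun x => (x.2 + 1) * x.1.1.natDegree).sum = n}

theorem card_classes [Fintype F] (n : ℕ) : Nat.card (Quot (fun A B : Matrix (Fin n) (Fin n) F =>
      ∃ g : GL (Fin n) F, B = (g : Matrix (Fin n) (Fin n) F) * A * ((g⁻¹ : GL (Fin n) F) : Matrix (Fin n) (Fin n) F)))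
    = Nat.card (DD F n) := by
  have h1 : ∀ A : Matrix (Fin n) (Fin n) F, ∃ s : DD F n,
      Nonempty (AEval' (Matrix.toLin' A) ≃ₗ[F[X]] NMod s.1) := by
    intro A
    obtain ⟨s, ⟨φ⟩⟩ := exists_multiset (AEval' (Matrix.toLin' A))
      (AEval.isTorsion_of_finiteDimensional _ _ _)
    refine ⟨⟨s, ?_⟩, ⟨φ⟩⟩
    rw [← finrank_NMod, ← (φ.restrictScalars F).finrank_eq, ← (AEval'.of (Matrix.toLin' A)).finrank_eq]
    simp
  choose c hc using h1
  refine Nat.card_congr (Equiv.ofBijective (Quot.lift c ?_) ⟨?_, ?_⟩)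
  · intro A B h
    obtain ⟨φ⟩ := (similar_iff A B).mp h
    exact Subtype.ext (unique _ _ ((hc A).some.symm.trans (φ.trans (hc B).some)))
  · rintro ⟨A⟩ ⟨B⟩ h
    have h : c A = c B := h
    apply Quot.sound
    refine (similar_iff A B).mpr ?_
    have hA := hc A
    rw [h] at hA
    exact ⟨hA.some.trans (hc B).some.symm⟩
  · intro s
    have := finite_NMod s.1
    obtain ⟨A, ⟨φ⟩⟩ := exists_matrix (NMod s.1) ((finrank_NMod s.1).trans s.2)
    exact ⟨Quot.mk _ A, Subtype.ext (unique _ _ ((hc A).some.symm.trans φ))⟩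

/-- positive multisets vs Young diagrams -/
noncomputable def partEquiv (n : ℕ) : n.Partition ≃ {μ : YoungDiagram // μ.rowLens.sum = n} where
  toFun lam := ⟨YoungDiagram.ofRowLens (lam.parts.sort (· ≥ ·)) (Multiset.pairwise_sort _ _).sortedGE, by
    rw [YoungDiagram.rowLens_ofRowLens_eq_self (fun x hx => lam.parts_pos (by simpa using hx)),
      ← Multiset.sum_coe, Multiset.sort_eq, lam.parts_sum]⟩
  invFun μ := ⟨(μ.1.rowLens : Multiset ℕ), fun {i} hi => μ.1.pos_of_mem_rowLens i (by simpa using hi), by simpa using μ.2⟩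
  left_inv := by
    intro lam
    ext1
    simp only
    rw [YoungDiagram.rowLens_ofRowLens_eq_self (fun x hx => lam.parts_pos (by simpa using hx)),
      Multiset.sort_eq]
  right_inv := by
    intro μ
    apply Subtype.ext
    simp only
    have h : Multiset.sort (μ.1.rowLens : Multiset ℕ) (· ≥ ·) = μ.1.rowLens := by
      rw [Multiset.coe_sort]
      exact List.mergeSort_eq_self _ (by simpa using μ.1.rowLens_sorted.pairwise)
    simp only [h]
    exact YoungDiagram.ofRowLens_to_rowLens_eq_self

theorem sum_rowLens (μ : YoungDiagram) : μ.rowLens.sum = μ.card := by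
  have h : μ.rowLens.sum = ∑ i ∈ Finset.range (μ.colLen 0), μ.rowLen i := by
    simp [YoungDiagram.rowLens, Finset.sum, Finset.range, Multiset.range]
  have h2 : ∀ c ∈ μ.cells, c.1 ∈ Finset.range (μ.colLen 0) := by
    intro c hc
    rw [Finset.mem_range, ← YoungDiagram.mem_iff_lt_colLen]
    exact μ.up_left_mem le_rfl (Nat.zero_le _) (by simpa using hc)
  rw [h, YoungDiagram.card, Finset.card_eq_sum_card_fiberwise h2]
  refine Finset.sum_congr rfl fun i _ => ?_
  rw [YoungDiagram.rowLen_eq_card]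
  rfl

theorem sup_rowLens (μ : YoungDiagram) : (μ.rowLens : Multiset ℕ).sup = μ.rowLen 0 := by
  apply le_antisymm
  · rw [Multiset.sup_le]
    intro b hb
    simp only [YoungDiagram.rowLens, Multiset.mem_coe, List.mem_map] at hb
    obtain ⟨i, -, rfl⟩ := hb
    exact μ.rowLen_anti _ _ (Nat.zero_le _)
  · rcases Nat.eq_zero_or_pos (μ.rowLen 0) with h | h
    · rw [h]; exact Nat.zero_le _
    · apply Multiset.le_sup
      simp only [YoungDiagram.rowLens, Multiset.mem_coe, List.mem_map]
      refine ⟨0, ?_, rfl⟩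
      rw [List.mem_range, ← YoungDiagram.mem_iff_lt_colLen, YoungDiagram.mem_iff_lt_rowLen]
      exact h

noncomputable def transEquiv (n : ℕ) :
    {μ : YoungDiagram // μ.rowLens.sum = n} ≃ {μ : YoungDiagram // μ.rowLens.sum = n} :=
  YoungDiagram.transposeOrderIso.toEquiv.subtypeEquiv (fun μ => by
    rw [sum_rowLens, sum_rowLens]
    simp [YoungDiagram.transposeOrderIso, YoungDiagram.transpose, YoungDiagram.card])

theorem conj_sum (n q : ℕ) : ∑ lam : n.Partition, q ^ (lam.parts.sup) =
    ∑ lam : n.Partition, q ^ (Multiset.card lam.parts) := by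
  symm
  refine Fintype.sum_equiv ((partEquiv n).trans ((transEquiv n).trans (partEquiv n).symm)) _ _ ?_
  intro lam
  obtain ⟨μ, rfl⟩ := (partEquiv n).symm.surjective lam
  simp only [Equiv.trans_apply, Equiv.apply_symm_apply]
  congr 1
  change _ = (((transEquiv n μ).1.rowLens : Multiset ℕ)).sup
  rw [sup_rowLens]
  change μ.1.rowLens.length = _
  rw [YoungDiagram.length_rowLens]
  change _ = μ.1.transpose.rowLen 0
  simp

theorem sum_count (n : ℕ) (f : ℕ → ℕ) (s : Multiset ℕ) (h : ∀ x ∈ s, 0 < x ∧ x ≤ n) :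
    ∑ k : Fin n, f (k.1 + 1) * s.count (k.1 + 1) = (s.map f).sum := by
  induction s using Multiset.induction_on with
  | empty => simp
  | cons a s ih =>
    have ha := h a (Multiset.mem_cons_self a s)
    simp only [Multiset.map_cons, Multiset.sum_cons, Multiset.count_cons, mul_add, Finset.sum_add_distrib]
    rw [ih fun x hx => h x (Multiset.mem_cons_of_mem hx), add_comm]
    congr 1
    rw [Finset.sum_eq_single (⟨a - 1, by omega⟩ : Fin n)]
    · have : a - 1 + 1 = a := by omega
      simp [this]
    · intro b _ hb
      have : ¬ b.1 + 1 = a := by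
        intro h; apply hb; apply Fin.ext; simp; omega
      simp [this]
    · simp

theorem part_bd {n : ℕ} (lam : n.Partition) : ∀ x ∈ lam.parts, 0 < x ∧ x ≤ n :=
  fun _ hx => ⟨lam.parts_pos hx, Nat.Partition.le_of_mem_parts hx⟩

def mkPart {n : ℕ} (e : Fin n → ℕ) (h : ∑ k : Fin n, (k.1 + 1) * e k = n) : n.Partition where
  parts := ∑ k : Fin n, Multiset.replicate (e k) (k.1 + 1)
  parts_pos := by
    intro i hi
    rw [Multiset.mem_sum] at hi
    obtain ⟨k, -, hk⟩ := hi
    rw [Multiset.eq_of_mem_replicate hk]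
    omega
  parts_sum := by
    rw [Multiset.sum_sum]
    conv_rhs => rw [← h]
    refine Finset.sum_congr rfl fun k _ => ?_
    simp [mul_comm]

theorem count_mkPart {n : ℕ} (e : Fin n → ℕ) (h : ∑ k : Fin n, (k.1 + 1) * e k = n) (k : Fin n) :
    (mkPart e h).parts.count (k.1 + 1) = e k := by
  simp only [mkPart, Multiset.count_sum', Multiset.count_replicate]
  rw [Finset.sum_eq_single k]
  · simp
  · intro b _ hb
    have : b.1 ≠ k.1 := fun h => hb (Fin.ext h)
    simp [this]
  · simp

theorem mkPart_eq_iff {n : ℕ} (e : Fin n → ℕ) (h : ∑ k : Fin n, (k.1 + 1) * e k = n) (lam : n.Partition) :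
    mkPart e h = lam ↔ ∀ k : Fin n, e k = lam.parts.count (k.1 + 1) := by
  constructor
  · rintro rfl k
    rw [count_mkPart]
  · intro hk
    ext1
    ext a
    by_cases ha : 0 < a ∧ a ≤ n
    · have h1 := count_mkPart e h ⟨a - 1, by omega⟩
      have h2 := hk ⟨a - 1, by omega⟩
      have h3 : a - 1 + 1 = a := by omega
      simp only [h3] at h1 h2
      rw [h1, h2]
    · rw [Multiset.count_eq_zero_of_notMem fun hm => ha (part_bd _ _ hm),
        Multiset.count_eq_zero_of_notMem fun hm => ha (part_bd _ _ hm)]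

theorem card_family (n q : ℕ) (hq : 0 < q) (X : Type) (d : X → ℕ)
    (hd : ∀ j, Nat.card {x // d x = j} = q ^ j) :
    Nat.card {h : Fin n → X // ∑ k : Fin n, (k.1 + 1) * d (h k) = n} =
      ∑ lam : n.Partition, q ^ (Multiset.card lam.parts) := by
  let E := {h : Fin n → X // ∑ k : Fin n, (k.1 + 1) * d (h k) = n}
  let L : E → n.Partition := fun h => mkPart (fun k => d (h.1 k)) h.2
  have fib : ∀ lam : n.Partition,
      Nonempty ({h : E // L h = lam} ≃ ((k : Fin n) → {x : X // d x = lam.parts.count (k.1 + 1)})) := by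
    intro lam
    refine ⟨{ toFun := fun h k => ⟨h.1.1 k, (mkPart_eq_iff _ h.1.2 lam).mp h.2 k⟩
              invFun := fun h => ⟨⟨fun k => (h k).1, ?_⟩, ?_⟩
              left_inv := fun h => rfl
              right_inv := fun h => rfl }⟩
    · simp only [fun k => (h k).2]
      rw [sum_count n (fun x => x) _ (part_bd lam)]
      simp [lam.parts_sum]
    · exact (mkPart_eq_iff _ _ lam).mpr fun k => (h k).2
  have hfin : ∀ j, Finite {x // d x = j} := fun j => Nat.finite_of_card_ne_zero (by
    rw [hd]; positivity)
  have : ∀ lam, Finite {h : E // L h = lam} := fun lam => Finite.of_equiv _ (fib lam).some.symm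
  rw [← Nat.card_congr (Equiv.sigmaFiberEquiv L), Nat.card_sigma]
  refine Finset.sum_congr rfl fun lam _ => ?_
  rw [Nat.card_congr (fib lam).some, Nat.card_pi]
  simp only [hd]
  rw [Finset.prod_pow_eq_pow_sum]
  congr 1
  have := sum_count n (fun _ => 1) _ (part_bd lam)
  simpa using this

noncomputable def dg (m : Multiset (MI F)) : ℕ := (m.map fun p => p.1.natDegree).sum

theorem monic_pr (m : Multiset (MI F)) : (m.map fun p : MI F => p.1).prod.Monic :=
  monic_multiset_prod_of_monic _ _ fun p _ => p.2.1

theorem natDegree_pr (m : Multiset (MI F)) : (m.map fun p : MI F => p.1).prod.natDegree = dg m := by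
  rw [natDegree_multiset_prod_of_monic _ (by
    intro f hf
    obtain ⟨p, -, rfl⟩ := Multiset.mem_map.mp hf
    exact p.2.1), Multiset.map_map]
  rfl

open UniqueFactorizationMonoid in
theorem card_dg [Fintype F] (j : ℕ) : Nat.card {m : Multiset (MI F) // dg m = j} = Fintype.card F ^ j := by
  classical
  have h1 : Nat.card {f : F[X] // f.Monic ∧ f.natDegree = j} = Fintype.card F ^ j := by
    rw [Nat.card_congr ((monicEquivDegreeLT j).trans (degreeLTEquiv F j).toEquiv)]
    simp
  rw [← h1]
  refine Nat.card_congr (Equiv.ofBijective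
    (fun m => ⟨(m.1.map fun p : MI F => p.1).prod, monic_pr _, (natDegree_pr _).trans m.2⟩) ⟨?_, ?_⟩)
  · intro m m' h
    have h2 : (m.1.map fun p : MI F => p.1).prod = (m'.1.map fun p : MI F => p.1).prod := congrArg Subtype.val h
    have key : ∀ m : Multiset (MI F), normalizedFactors (m.map fun p : MI F => p.1).prod = m.map fun p : MI F => p.1 := by
      intro m
      rw [normalizedFactors_prod_eq _ (by
        intro f hf
        obtain ⟨p, -, rfl⟩ := Multiset.mem_map.mp hf
        exact p.2.2), Multiset.map_map]
      refine Multiset.map_congr rfl fun p _ => ?_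
      exact p.2.1.normalize_eq_self
    have h3 := congrArg normalizedFactors h2
    rw [key, key] at h3
    exact Subtype.ext (Multiset.map_injective Subtype.val_injective h3)
  · rintro ⟨f, hf, hj⟩
    have hlift : ∃ m : Multiset (MI F), m.map (fun p => p.1) = normalizedFactors f := by
      have : ∀ g ∈ normalizedFactors f, g.Monic ∧ Irreducible g := fun g hg =>
        ⟨by
          rw [← normalize_normalized_factor g hg]
          exact monic_normalize (irreducible_of_normalized_factor g hg).ne_zero,
          irreducible_of_normalized_factor g hg⟩
      exact ⟨(normalizedFactors f).attach.map fun g => ⟨g.1, this g.1 g.2⟩, by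
        rw [Multiset.map_map]; simp⟩
    obtain ⟨m, hm⟩ := hlift
    have hp : (m.map fun p : MI F => p.1).prod = f := by
      rw [hm, prod_normalizedFactors_eq hf.ne_zero, hf.normalize_eq_self]
    refine ⟨⟨m, ?_⟩, Subtype.ext hp⟩
    rw [← natDegree_pr, hp, hj]

theorem count_T {α : Type} [DecidableEq α] {n : ℕ} (t : Fin n → Multiset α) (a : α) (k : Fin n) :
    (∑ k : Fin n, (t k).map fun a => (a, k.1)).count (a, k.1) = (t k).count a := by
  rw [Multiset.count_sum', Finset.sum_eq_single k]
  · exact Multiset.count_map_eq_count' (fun a => (a, k.1)) _ (fun x y h => by simpa using h) a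
  · intro b _ hb
    apply Multiset.count_eq_zero_of_notMem
    intro h
    obtain ⟨x, -, hx⟩ := Multiset.mem_map.mp h
    exact hb (Fin.ext (congrArg Prod.snd hx))
  · simp

theorem card_DD (n : ℕ) : Nat.card (DD F n) =
    Nat.card {h : Fin n → Multiset (MI F) // ∑ k : Fin n, (k.1 + 1) * dg (h k) = n} := by
  have hdeg : ∀ h : Fin n → Multiset (MI F),
     ((∑ k : Fin n, (h k).map fun a => (a, k.1)).map fun x => (x.2 + 1) * x.1.1.natDegree).sum
      = ∑ k : Fin n, (k.1 + 1) * dg (h k) := by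
    intro h
    rw [← Multiset.coe_mapAddMonoidHom, map_sum, Multiset.sum_sum]
    refine Finset.sum_congr rfl fun k _ => ?_
    simp only [Multiset.coe_mapAddMonoidHom, Multiset.map_map, Function.comp_def, dg]
    rw [Multiset.sum_map_mul_left]
  symm
  refine Nat.card_congr (Equiv.ofBijective
    (fun h => ⟨∑ k : Fin n, (h.1 k).map fun a => (a, k.1), (hdeg h.1).trans h.2⟩) ⟨?_, ?_⟩)
  · intro h h' e
    have e := congrArg Subtype.val e
    apply Subtype.ext
    funext k
    ext a
    rw [← count_T h.1 a k, ← count_T h'.1 a k]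
    exact congrArg _ e
  · rintro ⟨s, hs⟩
    have hlt : ∀ x ∈ s, x.2 < n := by
      intro x hx
      have h1 := Multiset.le_sum_of_mem (Multiset.mem_map_of_mem (fun x : MI F × ℕ => (x.2 + 1) * x.1.1.natDegree) hx)
      rw [hs] at h1
      have h2 : 0 < x.1.1.natDegree := x.1.2.2.natDegree_pos
      nlinarith
    let h : Fin n → Multiset (MI F) := fun k => (s.filter fun x => x.2 = k.1).map Prod.fst
    have hT : (∑ k : Fin n, (h k).map fun a => (a, k.1)) = s := by
      ext ⟨a, j⟩
      by_cases hj : j < n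
      · rw [count_T h a ⟨j, hj⟩]
        have : (s.filter fun x => x.2 = j) = (h ⟨j, hj⟩).map fun a => (a, j) := by
          simp only [h, Multiset.map_map]
          conv_lhs => rw [← Multiset.map_id (s.filter fun x => x.2 = j)]
          refine Multiset.map_congr rfl fun x hx => ?_
          rw [← (Multiset.mem_filter.mp hx).2]
          rfl
        rw [← Multiset.count_map_eq_count' (fun a => (a, j)) _ (fun x y h => by simpa using h) a, ← this,
          Multiset.count_filter_of_pos]
        rfl
      · rw [Multiset.count_eq_zero_of_notMem fun hm => hj (hlt _ hm), Multiset.count_eq_zero_of_notMem]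
        intro hm
        obtain ⟨k, -, hk⟩ := Multiset.mem_sum.mp hm
        obtain ⟨x, -, hx⟩ := Multiset.mem_map.mp hk
        have hkj : k.1 = j := congrArg Prod.snd hx
        exact hj (hkj ▸ k.2)
    exact ⟨⟨h, by rw [← hdeg, hT, hs]⟩, Subtype.ext hT⟩

end SimCount

/-- The number of similarity classes of `n × n` matrices over a finite field of
order `q` equals the sum over partitions `λ` of `n` of `q ^ λ₁`, where `λ₁` is
the largest part. -/
theorem stmt0 (n q : ℕ) (hn : 0 < n)
    (F : Type) [Field F] [Fintype F] (hF : Fintype.card F = q) :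
    Nat.card (Quot (fun A B : Matrix (Fin n) (Fin n) F =>
      ∃ g : GL (Fin n) F, B = (g : Matrix (Fin n) (Fin n) F) * A * ((g⁻¹ : GL (Fin n) F) : Matrix (Fin n) (Fin n) F))) =
    ∑ lam : n.Partition, q ^ (lam.parts.sup) := by
  subst hF
  rw [SimCount.card_classes, SimCount.card_DD, SimCount.conj_sum]
  exact SimCount.card_family n _ Fintype.card_pos _ _ SimCount.card_dg
end

section
/- Fix n ≥ 1 and a prime power q, and let m(n) = ⌊n²/4⌋ + 1. There exist positive constants C₁ and C₂ (depending on n and q but not k) such that C₁ · q^{m(n)k} ≤ c(n,k,q) ≤ C₂ · q^{m(n)k} for all sufficiently large k, where c(n,k,q) is the number of simultaneous similarity classes of k-tuples of pairwise commuting n×n matrices over F_q. -/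
open Module

lemma common_eigen {K : Type*} [Field K] [IsAlgClosed K] (d : ℕ) :
    ∀ {V : Type _} [AddCommGroup V] [Module K V] [FiniteDimensional K V] [Nontrivial V]
    (_ : finrank K V ≤ d)
    (S : Set (End K V)) (_ : ∀ f ∈ S, ∀ g ∈ S, Commute f g),
    ∃ v : V, v ≠ 0 ∧ ∀ f ∈ S, ∃ c : K, f v = c • v := by
  induction d with
  | zero =>
    intro V _ _ _ _ h
    have := finrank_pos (R := K) (M := V)
    omega
  | succ d ih =>
    intro V _ _ _ _ h S hS
    by_cases hsc : ∀ f ∈ S, ∃ c : K, ∀ v, f v = c • v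
    · obtain ⟨v, hv⟩ := exists_ne (0 : V)
      exact ⟨v, hv, fun f hf => (hsc f hf).imp fun c hc => hc v⟩
    push Not at hsc
    obtain ⟨f, hf, hfc⟩ := hsc
    obtain ⟨c, hc⟩ := Module.End.exists_eigenvalue f
    set W := Module.End.eigenspace f c with hW
    have hinv : ∀ g ∈ S, ∀ w ∈ W, g w ∈ W := by
      intro g hg w hw
      rw [hW, Module.End.mem_eigenspace_iff] at hw ⊢
      have := LinearMap.congr_fun (hS f hf g hg).eq w
      simp only [Module.End.mul_apply] at this
      rw [this, hw, map_smul]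
    have hlt : finrank K W < finrank K V := by
      apply Submodule.finrank_lt
      intro htop
      obtain ⟨v, hv⟩ := hfc c
      apply hv
      rw [← Module.End.mem_eigenspace_iff, ← hW, htop]
      trivial
    have : Nontrivial W := (Submodule.nontrivial_iff_ne_bot).2 hc
    obtain ⟨w, hw0, hw⟩ := ih (V := W) (by omega)
      {g' | ∃ g, ∃ hg : g ∈ S, g' = g.restrict (hinv g hg)} (by
        rintro _ ⟨g, hg, rfl⟩ _ ⟨g', hg', rfl⟩
        ext x
        have := LinearMap.congr_fun (hS g hg g' hg').eq x
        simpa using this)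
    refine ⟨w, by simpa using hw0, fun g hg => ?_⟩
    obtain ⟨c', hc'⟩ := hw _ ⟨g, hg, rfl⟩
    exact ⟨c', by simpa using congrArg Subtype.val hc'⟩

lemma schur_arith (n s k1 k2 : ℕ) (h1 : s ≤ n ^ 2 / 4 + 1 + k1)
    (h2 : s ≤ n ^ 2 / 4 + 1 + k2) (h : k1 + k2 ≤ n + 1) : s ≤ (n + 1) ^ 2 / 4 + 1 := by
  obtain ⟨a, rfl | rfl⟩ := Nat.even_or_odd' n
  · have e1 : (2 * a) ^ 2 / 4 = a * a := by
      rw [show (2 * a) ^ 2 = 4 * (a * a) by ring]; omega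
    have e2 : (2 * a + 1) ^ 2 / 4 = a * a + a := by
      rw [show (2 * a + 1) ^ 2 = 4 * (a * a + a) + 1 by ring]; omega
    omega
  · have e1 : (2 * a + 1 + 1) ^ 2 / 4 = a * a + 2 * a + 1 := by
      rw [show (2 * a + 1 + 1) ^ 2 = 4 * (a * a + 2 * a + 1) by ring]; omega
    have e2 : (2 * a + 1) ^ 2 / 4 = a * a + a := by
      rw [show (2 * a + 1) ^ 2 = 4 * (a * a + a) + 1 by ring]; omega
    omega

lemma schur {K : Type*} [Field K] [IsAlgClosed K] (n : ℕ) :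
    ∀ {V : Type _} [AddCommGroup V] [Module K V] [FiniteDimensional K V]
    (_ : finrank K V = n)
    (S : Submodule K (End K V)) (_ : ∀ f ∈ S, ∀ g ∈ S, Commute f g),
    finrank K S ≤ n ^ 2 / 4 + 1 := by
  induction n with
  | zero =>
    intro V _ _ _ h S hS
    have := S.finrank_le
    rw [finrank_linearMap, h] at this
    omega
  | succ n ih =>
    intro V _ _ _ h S hS
    rcases Nat.eq_zero_or_pos n with rfl | hn
    · have := S.finrank_le
      rw [finrank_linearMap, h] at this
      omega
    have : Nontrivial V := nontrivial_of_finrank_pos (R := K) (by omega)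
    obtain ⟨v, hv0, hv⟩ := common_eigen (K := K) (n + 1) h.le (S : Set (End K V)) hS
    set L : Submodule K V := K ∙ v with hL
    have hLinv : ∀ f : S, L ≤ L.comap (f : End K V) := by
      intro f
      rw [hL, Submodule.span_singleton_le_iff_mem, Submodule.mem_comap,
        Submodule.mem_span_singleton]
      obtain ⟨c, hc⟩ := hv f f.2
      exact ⟨c, hc.symm⟩
    have hLdim : finrank K (V ⧸ L) = n := by
      have := L.finrank_quotient_add_finrank
      have h1 : finrank K L = 1 := finrank_span_singleton hv0
      omega
    let ρ : S →ₗ[K] End K (V ⧸ L) :=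
      { toFun := fun f => L.mapQ L f (hLinv f)
        map_add' := fun f g => by ext; simp
        map_smul' := fun c f => by ext; simp }
    have hρ : ∀ f x, ρ f (L.mkQ x) = L.mkQ ((f : End K V) x) := fun f x => rfl
    have hρc : ∀ f ∈ LinearMap.range ρ, ∀ g ∈ LinearMap.range ρ, Commute f g := by
      rintro _ ⟨f, rfl⟩ _ ⟨g, rfl⟩
      apply LinearMap.ext
      intro x
      obtain ⟨x, rfl⟩ := L.mkQ_surjective x
      have := LinearMap.congr_fun (hS f f.2 g g.2).eq x
      simp only [Module.End.mul_apply, hρ] at this ⊢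
      rw [this]
    have h1 := ih hLdim (LinearMap.range ρ) hρc
    have : Nontrivial (V ⧸ L) := nontrivial_of_finrank_pos (R := K) (by omega)
    have : Nontrivial (Dual K (V ⧸ L)) :=
      nontrivial_of_finrank_pos (R := K) (by rw [Subspace.dual_finrank_eq]; omega)
    obtain ⟨φ, hφ0, hφ⟩ := common_eigen (K := K) (V := Dual K (V ⧸ L)) _ le_rfl
      {t | ∃ f : S, t = (ρ f).dualMap} (by
        rintro _ ⟨f, rfl⟩ _ ⟨g, rfl⟩
        have := hρc _ ⟨f, rfl⟩ _ ⟨g, rfl⟩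
        ext φ x
        have := LinearMap.congr_fun this.eq (L.mkQ x)
        simp only [Module.End.mul_apply] at this
        simp only [Module.End.mul_apply, LinearMap.dualMap_apply, LinearMap.comp_apply]
        rw [this])
    set ψ : Dual K V := φ ∘ₗ L.mkQ with hψ
    have hψ0 : ψ ≠ 0 := by
      intro h0
      apply hφ0
      ext x
      exact LinearMap.congr_fun h0 x
    have hψv : ψ v = 0 := by
      have : L.mkQ v = 0 := by
        rw [Submodule.mkQ_apply, Submodule.Quotient.mk_eq_zero]
        exact Submodule.mem_span_singleton_self v
      rw [hψ, LinearMap.comp_apply, this, map_zero]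
    have hψf : ∀ f : S, ∃ c : K, ∀ x, ψ ((f : End K V) x) = c * ψ x := by
      intro f
      obtain ⟨c, hc⟩ := hφ _ ⟨f, rfl⟩
      exact ⟨c, fun x => LinearMap.congr_fun hc (L.mkQ x)⟩
    set H := LinearMap.ker ψ with hH
    have hHdim : finrank K H = n := by
      have : finrank K H + 1 = finrank K V := Module.Dual.finrank_ker_add_one_of_ne_zero hψ0
      omega
    have hHinv : ∀ f : S, ∀ x ∈ H, (f : End K V) x ∈ H := by
      intro f x hx
      obtain ⟨c, hc⟩ := hψf f
      rw [hH, LinearMap.mem_ker] at hx ⊢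
      rw [hc, hx, mul_zero]
    let σ : S →ₗ[K] End K H :=
      { toFun := fun f => (f : End K V).restrict (hHinv f)
        map_add' := fun f g => by ext; simp
        map_smul' := fun c f => by ext; simp }
    have hσ : ∀ f x, ((σ f x : H) : V) = (f : End K V) x := fun f x => rfl
    have hσc : ∀ f ∈ LinearMap.range σ, ∀ g ∈ LinearMap.range σ, Commute f g := by
      rintro _ ⟨f, rfl⟩ _ ⟨g, rfl⟩
      ext x
      have := LinearMap.congr_fun (hS f f.2 g g.2).eq x
      simp only [Module.End.mul_apply, hσ] at this ⊢
      rw [this]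
    have h2 := ih hHdim (LinearMap.range σ) hσc
    have r1 := ρ.finrank_range_add_finrank_ker
    have r2 := σ.finrank_range_add_finrank_ker
    -- kernels
    obtain ⟨χ, hχ⟩ : ∃ χ : Dual K V, χ v = 1 := Projective.exists_dual_eq_one K hv0
    obtain ⟨u, hu⟩ : ∃ u : V, ψ u = 1 := by
      obtain ⟨u, hu⟩ := LinearMap.surjective hψ0 1
      exact ⟨u, hu⟩
    have hk1 : ∀ f ∈ LinearMap.ker ρ, ∀ x, (f : End K V) x = χ ((f : End K V) x) • v := by
      intro f hf x
      have : L.mkQ ((f : End K V) x) = 0 := by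
        rw [← hρ, LinearMap.mem_ker.1 hf]; rfl
      rw [Submodule.mkQ_apply, Submodule.Quotient.mk_eq_zero, hL,
        Submodule.mem_span_singleton] at this
      obtain ⟨c, hc⟩ := this
      rw [← hc, map_smul, hχ]; simp
    have hk2 : ∀ f ∈ LinearMap.ker σ, ∀ x, ψ x = 0 → (f : End K V) x = 0 := by
      intro f hf x hx
      have := hσ f ⟨x, hx⟩
      rw [LinearMap.mem_ker.1 hf] at this
      exact this.symm
    let α : LinearMap.ker ρ →ₗ[K] Dual K V :=
      { toFun := fun f => χ ∘ₗ (f : S).1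
        map_add' := fun f g => by ext; simp
        map_smul' := fun c f => by ext; simp }
    have hα : ∀ f x, α f x = χ (f.1.1 x) := fun f x => rfl
    let β : LinearMap.ker σ →ₗ[K] V :=
      { toFun := fun f => (f : S).1 u
        map_add' := fun f g => by simp
        map_smul' := fun c f => by simp }
    have hβ : ∀ f, β f = f.1.1 u := fun f => rfl
    have hαi : Function.Injective α := by
      rw [injective_iff_map_eq_zero]
      intro f hf
      apply Subtype.ext
      apply Subtype.ext
      apply LinearMap.ext
      intro x
      have := hk1 f f.2 x
      rw [← hα, hf] at this
      simpa using this
    have hβi : Function.Injective β := by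
      rw [injective_iff_map_eq_zero]
      intro f hf
      apply Subtype.ext
      apply Subtype.ext
      apply LinearMap.ext
      intro x
      have := hk2 f f.2 (x - ψ x • u) (by simp [hu])
      rw [map_sub, map_smul, ← hβ, hf] at this
      simpa using this
    have hann : LinearMap.range α ≤ (LinearMap.range β).dualAnnihilator := by
      rintro _ ⟨f, rfl⟩
      rw [Submodule.mem_dualAnnihilator]
      rintro _ ⟨g, rfl⟩
      have := LinearMap.congr_fun (hS f.1 f.1.2 g.1 g.1.2).eq u
      simp only [Module.End.mul_apply] at this
      rw [hα, hβ, this, hk1 f f.2 u, map_smul, hk2 g g.2 v hψv]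
      simp
    have h3 := Submodule.finrank_mono hann
    have h4 := Subspace.finrank_add_finrank_dualAnnihilator_eq (LinearMap.range β)
    rw [LinearMap.finrank_range_of_inj hαi] at h3
    rw [LinearMap.finrank_range_of_inj hβi] at h4
    exact schur_arith n _ _ _ (by omega) (by omega) (by omega : finrank K (LinearMap.ker ρ) + finrank K (LinearMap.ker σ) ≤ n + 1)

lemma linInd_map {F : Type*} [Field F] {n : ℕ} {ι : Type*} [Fintype ι]
    (A : ι → Matrix (Fin n) (Fin n) F) (hA : LinearIndependent F A) :
    LinearIndependent (AlgebraicClosure F)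
      (fun i => (A i).map (algebraMap F (AlgebraicClosure F))) := by
  rw [Fintype.linearIndependent_iff] at hA ⊢
  intro g hg i
  rw [← Module.forall_dual_apply_eq_zero_iff F]
  intro φ
  refine hA (fun i => φ (g i)) ?_ i
  ext a b
  have := congrArg φ (congrFun (congrFun hg a) b)
  simp only [Matrix.sum_apply, Matrix.smul_apply, Matrix.map_apply, smul_eq_mul, map_sum,
    Matrix.zero_apply, map_zero] at this ⊢
  rw [← this]
  refine Finset.sum_congr rfl fun j _ => ?_
  rw [mul_comm (g j), ← Algebra.smul_def, map_smul, smul_eq_mul, mul_comm]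

lemma schur_matrix {F : Type*} [Field F] {n : ℕ}
    (S : Submodule F (Matrix (Fin n) (Fin n) F)) (hS : ∀ f ∈ S, ∀ g ∈ S, Commute f g) :
    finrank F S ≤ n ^ 2 / 4 + 1 := by
  let b := finBasis F S
  have hb : LinearIndependent F (fun i => (b i : Matrix (Fin n) (Fin n) F)) :=
    b.linearIndependent.map' S.subtype (by simp)
  have h1 := linInd_map _ hb
  set K := AlgebraicClosure F
  have h2 := h1.map' (Matrix.toLinAlgEquiv' (R := K) (n := Fin n)).toLinearMap (by
    rw [LinearMap.ker_eq_bot]; exact (Matrix.toLinAlgEquiv' (R := K) (n := Fin n)).injective)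
  have h3 := finrank_span_eq_card h2
  rw [Fintype.card_fin] at h3
  rw [← h3]
  refine schur (K := K) n (V := Fin n → K) (by simp) _ ?_
  have key : ∀ i j, Commute ((b i : Matrix (Fin n) (Fin n) F).map (algebraMap F K))
      ((b j : Matrix (Fin n) (Fin n) F).map (algebraMap F K)) := fun i j =>
    (hS _ (b i).2 _ (b j).2).map (algebraMap F K).mapMatrix
  intro f hf g hg
  induction hf using Submodule.span_induction with
  | zero => exact Commute.zero_left _
  | add x y _ _ hx hy => exact hx.add_left hy
  | smul c x _ hx => exact hx.smul_left c
  | mem x hx =>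
    obtain ⟨i, rfl⟩ := hx
    induction hg using Submodule.span_induction with
    | zero => exact Commute.zero_right _
    | add x y _ _ hx hy => exact hx.add_right hy
    | smul c x _ hx => exact hx.smul_right c
    | mem x hx =>
      obtain ⟨j, rfl⟩ := hx
      exact (key i j).map (Matrix.toLinAlgEquiv' (R := K) (n := Fin n))

abbrev CT (F : Type) [Field F] (n k : ℕ) :=
  {T : Fin k → Matrix (Fin n) (Fin n) F // ∀ i j, Commute (T i) (T j)}

abbrev simRel (F : Type) [Field F] (n k : ℕ) (A B : CT F n k) : Prop :=
  ∃ g : GL (Fin n) F, ∀ i, B.val i =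
            (g : Matrix (Fin n) (Fin n) F) * A.val i *
              ((g⁻¹ : GL (Fin n) F) : Matrix (Fin n) (Fin n) F)

lemma card_CT_le (F : Type) [Field F] [Fintype F] (n k : ℕ) :
    Nat.card (CT F n k) ≤ Nat.card (Submodule F (Matrix (Fin n) (Fin n) F)) *
      Fintype.card F ^ ((n ^ 2 / 4 + 1) * k) := by
  classical
  let C := {S : Submodule F (Matrix (Fin n) (Fin n) F) // ∀ f ∈ S, ∀ g ∈ S, Commute f g}
  have : Fintype C := Fintype.ofFinite C
  have hinj : ∀ T : CT F n k, ∃ x : (Σ S : C, Fin k → S.1), T.1 = fun i => (x.2 i).1 := by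
    intro T
    refine ⟨⟨⟨Submodule.span F (Set.range T.1), ?_⟩,
      fun i => ⟨T.1 i, Submodule.subset_span ⟨i, rfl⟩⟩⟩, rfl⟩
    intro f hf g hg
    induction hf using Submodule.span_induction with
    | zero => exact Commute.zero_left _
    | add x y _ _ hx hy => exact hx.add_left hy
    | smul c x _ hx => exact hx.smul_left c
    | mem x hx =>
      obtain ⟨i, rfl⟩ := hx
      induction hg using Submodule.span_induction with
      | zero => exact Commute.zero_right _
      | add x y _ _ hx hy => exact hx.add_right hy
      | smul c x _ hx => exact hx.smul_right c
      | mem x hx =>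
        obtain ⟨j, rfl⟩ := hx
        exact T.2 i j
  choose e he using hinj
  have hei : Function.Injective e := by
    intro T T' h
    apply Subtype.ext
    rw [he T, he T', h]
  refine (Nat.card_le_card_of_injective e hei).trans ?_
  rw [Nat.card_sigma]
  calc ∑ S : C, Nat.card (Fin k → S.1) ≤ ∑ S : C, Fintype.card F ^ ((n ^ 2 / 4 + 1) * k) := by
        refine Finset.sum_le_sum fun S _ => ?_
        rw [Nat.card_fun, Nat.card_fin, Module.natCard_eq_pow_finrank (K := F), ← pow_mul,
          Nat.card_eq_fintype_card]
        exact Nat.pow_le_pow_right Fintype.card_pos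
          (Nat.mul_le_mul_right _ (schur_matrix S.1 S.2))
    _ = Nat.card C * Fintype.card F ^ ((n ^ 2 / 4 + 1) * k) := by
        simp [Nat.card_eq_fintype_card]
    _ ≤ _ := Nat.mul_le_mul_right _
        (Nat.card_le_card_of_injective Subtype.val Subtype.val_injective)

lemma pow_le_card_CT (F : Type) [Field F] [Fintype F] (n k : ℕ) (hn : 1 ≤ n) :
    Fintype.card F ^ ((n ^ 2 / 4 + 1) * k) ≤ Nat.card (CT F n k) := by
  classical
  obtain ⟨a, b, hb, hab, hm⟩ : ∃ a b : ℕ, 0 < b ∧ a + b = n ∧ n ^ 2 / 4 = a * b := by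
    obtain ⟨a, rfl | rfl⟩ := Nat.even_or_odd' n
    · refine ⟨a, a, by omega, by omega, ?_⟩
      rw [show (2 * a) ^ 2 = 4 * (a * a) by ring]; omega
    · refine ⟨a, a + 1, by omega, by omega, ?_⟩
      rw [show (2 * a + 1) ^ 2 = 4 * (a * (a + 1)) + 1 by ring]; omega
  subst hab
  let P := F × Matrix (Fin a) (Fin b) F
  let E := Matrix.reindexAlgEquiv F F (finSumFinEquiv (m := a) (n := b))
  let m : P → Matrix (Fin a ⊕ Fin b) (Fin a ⊕ Fin b) F := fun p =>
    Matrix.fromBlocks (p.1 • 1) p.2 0 (p.1 • 1)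
  have hmi : Function.Injective m := by
    intro p p' h
    obtain ⟨h1, h2, h3, h4⟩ := Matrix.fromBlocks_inj.1 h
    refine Prod.ext ?_ h2
    have := congrFun (congrFun h4 ⟨0, hb⟩) ⟨0, hb⟩
    simpa using this
  have hmc : ∀ p p', Commute (m p) (m p') := by
    intro p p'
    simp only [m, Commute, SemiconjBy, Matrix.fromBlocks_multiply]
    simp [add_comm, smul_comm p.1 p'.1]
  let Φ : (Fin k → P) → CT F (a + b) k := fun t =>
    ⟨fun i => E (m (t i)), fun i j => (hmc _ _).map E⟩
  have hΦ : Function.Injective Φ := by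
    intro t t' h
    funext i
    exact hmi (E.injective (congrFun (congrArg Subtype.val h) i))
  have := Nat.card_le_card_of_injective Φ hΦ
  refine le_trans (le_of_eq ?_) this
  rw [Nat.card_fun, Nat.card_fin, Nat.card_prod, hm]
  rw [show Nat.card (Matrix (Fin a) (Fin b) F) = Nat.card (Fin a → Fin b → F) from rfl]
  rw [Nat.card_fun, Nat.card_fun, Nat.card_fin, Nat.card_fin, Nat.card_eq_fintype_card,
    ← pow_mul, mul_comm b a, ← pow_succ', ← pow_mul]

lemma card_CT_le_quot (F : Type) [Field F] [Fintype F] (n k : ℕ) :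
    Nat.card (CT F n k) ≤ Nat.card (GL (Fin n) F) * Nat.card (Quot (simRel F n k)) := by
  classical
  have heq : Equivalence (simRel F n k) := by
    refine ⟨fun A => ⟨1, by simp⟩, ?_, ?_⟩
    · rintro A B ⟨g, hg⟩
      refine ⟨g⁻¹, fun i => ?_⟩
      rw [hg i, inv_inv]
      simp only [← mul_assoc, Units.inv_mul, one_mul]
      simp only [mul_assoc, Units.inv_mul, mul_one]
    · rintro A B C ⟨g, hg⟩ ⟨g', hg'⟩
      refine ⟨g' * g, fun i => ?_⟩
      rw [hg' i, hg i, mul_inv_rev]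
      simp only [Units.val_mul, mul_assoc]
  have : ∀ A : CT F n k, ∃ g : GL (Fin n) F, ∀ i, A.val i =
      (g : Matrix (Fin n) (Fin n) F) * (Quot.mk (simRel F n k) A).out.val i *
              ((g⁻¹ : GL (Fin n) F) : Matrix (Fin n) (Fin n) F) := by
    intro A
    have h := Quot.out_eq (Quot.mk (simRel F n k) A)
    exact (heq.quot_mk_eq_iff _ _).1 h
  choose g hg using this
  rw [← Nat.card_prod]
  refine Nat.card_le_card_of_injective (fun A => (g A, Quot.mk (simRel F n k) A)) ?_
  intro A B h
  obtain ⟨h1, h2⟩ := Prod.ext_iff.1 h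
  simp only at h1 h2
  apply Subtype.ext
  funext i
  rw [hg A, hg B, h1, h2]

theorem stmt16 (n q : ℕ) (hn : 1 ≤ n) (F : Type) [Field F] [Fintype F]
    (hF : Fintype.card F = q) :
    ∃ C₁ C₂ : ℝ, 0 < C₁ ∧ 0 < C₂ ∧ ∃ K : ℕ, ∀ k : ℕ, K ≤ k →
      C₁ * (q : ℝ) ^ ((n ^ 2 / 4 + 1) * k) ≤
        (Nat.card (Quot (fun A B :
            {T : Fin k → Matrix (Fin n) (Fin n) F // ∀ i j, Commute (T i) (T j)} =>
          ∃ g : GL (Fin n) F, ∀ i, B.val i =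
            (g : Matrix (Fin n) (Fin n) F) * A.val i *
              ((g⁻¹ : GL (Fin n) F) : Matrix (Fin n) (Fin n) F))) : ℝ) ∧
      (Nat.card (Quot (fun A B :
            {T : Fin k → Matrix (Fin n) (Fin n) F // ∀ i j, Commute (T i) (T j)} =>
          ∃ g : GL (Fin n) F, ∀ i, B.val i =
            (g : Matrix (Fin n) (Fin n) F) * A.val i *
              ((g⁻¹ : GL (Fin n) F) : Matrix (Fin n) (Fin n) F))) : ℝ) ≤
        C₂ * (q : ℝ) ^ ((n ^ 2 / 4 + 1) * k) := by
  subst hF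
  classical
  have hG : 0 < (Nat.card (GL (Fin n) F) : ℝ) := by exact_mod_cast Nat.card_pos
  refine ⟨(Nat.card (GL (Fin n) F) : ℝ)⁻¹,
    (Nat.card (Submodule F (Matrix (Fin n) (Fin n) F)) : ℝ), by positivity,
    by exact_mod_cast Nat.card_pos, 0, fun k _ => ⟨?_, ?_⟩⟩
  · rw [inv_mul_le_iff₀ hG]
    exact_mod_cast (pow_le_card_CT F n k hn).trans (card_CT_le_quot F n k)
  · have : Nat.card (Quot (simRel F n k)) ≤ Nat.card (CT F n k) :=
      Nat.card_le_card_of_surjective _ Quot.mk_surjective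
    exact_mod_cast this.trans (card_CT_le F n k)
end
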